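/- There is a universal constant C > 0 such that the following holds. Let H ⊆ ℝ^n be a finite set with inference dimension d ≥ 2. Then there exists a subset S ⊆ H of size |S| ≤ min(|H|, C·(d + n·log₂ d)) such that for every x ∈ ℝ^n, |infer(S,x) ∩ H| ≥ |H|/8. -/

import Mathlib

open Finset

namespace LDT

/-- The standard inner product on `ℝ^n`. -/
def ip {n : ℕ} (x h : Fin n → ℝ) : ℝ := ∑ i, x i * h i

/-- `S` infers `h` at `x`: the sign of `⟨x,h⟩` is determined by the signs of `⟨x,v⟩` for
`v ∈ S ∪ (S - S)`, i.e. every `x'` with the same sign pattern as `x` on `S ∪ (S-S)` gives the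
same sign on `h`. -/
def Infers {n : ℕ} (S : Finset (Fin n → ℝ)) (x h : Fin n → ℝ) : Prop :=
  ∀ x' : Fin n → ℝ,
    (∀ v ∈ S, SignType.sign (ip x' v) = SignType.sign (ip x v)) →
    (∀ v ∈ S, ∀ w ∈ S, SignType.sign (ip x' (v - w)) = SignType.sign (ip x (v - w))) →
    SignType.sign (ip x' h) = SignType.sign (ip x h)

/-- `H` has inference dimension at most `d`: every subset `S ⊆ H` of size at least `d` contains,
for every `x`, an element `h` inferred by `S \ {h}` at `x`. -/
def InfProp {n : ℕ} (H : Finset (Fin n → ℝ)) (d : ℕ) : Prop :=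
  ∀ S ⊆ H, d ≤ S.card → ∀ x : Fin n → ℝ, ∃ h ∈ S, Infers (S.erase h) x h

open scoped Classical

theorem sign_add_of_sign_eq {a b p q : ℝ} (hp : 0 < p) (hq : 0 < q)
    (h : SignType.sign a = SignType.sign b) :
    SignType.sign (p * a + q * b) = SignType.sign b := by
  rcases lt_trichotomy b 0 with hb | hb | hb
  · rw [sign_neg hb] at h ⊢
    rw [sign_eq_neg_one_iff] at h ⊢
    nlinarith [mul_pos hp (neg_pos.2 h), mul_pos hq (neg_pos.2 hb)]
  · subst hb
    rw [sign_zero, sign_eq_zero_iff] at h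
    simp [h]
  · rw [sign_pos hb] at h ⊢
    rw [sign_eq_one_iff] at h ⊢
    positivity

/-- The cells of an arrangement of hyperplanes, given by linear forms on a subspace `W`, have a
system of representatives of size polynomial in the number of forms. -/
theorem exists_sign_representatives {V : Type*} [AddCommGroup V] [Module ℝ V]
    [FiniteDimensional ℝ V] (F : Finset (Module.Dual ℝ V)) (W : Submodule ℝ V) :
    ∃ R : Finset V, R.card ≤ (3 * F.card + 1) ^ Module.finrank ℝ W ∧
      ∀ x ∈ W, ∃ r ∈ R, r ∈ W ∧ ∀ f ∈ F, SignType.sign (f r) = SignType.sign (f x) := by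
  induction F using Finset.induction_on generalizing W with
  | empty => exact ⟨{0}, by simp, fun x _ => ⟨0, by simp⟩⟩
  | insert v F hv ih =>
    obtain ⟨R, hRc, hR⟩ := ih W
    rw [card_insert_of_notMem hv]
    by_cases hW : W ≤ LinearMap.ker v
    · refine ⟨R, hRc.trans (Nat.pow_le_pow_left (by omega) _), fun x hx => ?_⟩
      obtain ⟨r, hr, hrW, hs⟩ := hR x hx
      refine ⟨r, hr, hrW, ?_⟩
      simp only [forall_mem_insert]
      refine ⟨?_, hs⟩
      rw [LinearMap.mem_ker.1 (hW hx), LinearMap.mem_ker.1 (hW hrW)]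
    · obtain ⟨R₀, hR₀c, hR₀⟩ := ih (W ⊓ LinearMap.ker v)
      have hlt : Module.finrank ℝ (W ⊓ LinearMap.ker v : Submodule ℝ V) < Module.finrank ℝ W :=
        Submodule.finrank_lt_finrank_of_lt (lt_of_le_of_ne inf_le_left
          (fun h => hW (inf_eq_left.1 h)))
      have hchoice : ∀ (σ : SignType) (r : V), ∃ y : V,
          (∃ z ∈ W, (∀ f ∈ F, SignType.sign (f z) = SignType.sign (f r)) ∧
            SignType.sign (v z) = σ) →
          y ∈ W ∧ (∀ f ∈ F, SignType.sign (f y) = SignType.sign (f r)) ∧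
            SignType.sign (v y) = σ := by
        intro σ r
        by_cases h : ∃ z ∈ W, (∀ f ∈ F, SignType.sign (f z) = SignType.sign (f r)) ∧
            SignType.sign (v z) = σ
        · obtain ⟨z, hz⟩ := h
          exact ⟨z, fun _ => hz⟩
        · exact ⟨0, fun h' => absurd h' h⟩
      choose p hp using hchoice
      refine ⟨R ∪ ((univ : Finset SignType) ×ˢ R₀).image (fun y => p y.1 y.2), ?_, ?_⟩
      · obtain ⟨w, hw⟩ : ∃ w, Module.finrank ℝ W = w + 1 := ⟨Module.finrank ℝ W - 1, by omega⟩
        have h₀ : R₀.card ≤ (3 * F.card + 1) ^ w :=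
          hR₀c.trans (Nat.pow_le_pow_right (by omega) (by omega))
        have h₁ := card_union_le R
          (((univ : Finset SignType) ×ˢ R₀).image (fun y => p y.1 y.2))
        have h₂ : (((univ : Finset SignType) ×ˢ R₀).image (fun y => p y.1 y.2)).card
            ≤ 3 * R₀.card := by
          refine card_image_le.trans ?_
          rw [card_product]
          exact le_of_eq rfl
        rw [hw] at hRc ⊢
        have h₃ : (3 * F.card + 1) ^ w ≤ (3 * (F.card + 1) + 1) ^ w :=
          Nat.pow_le_pow_left (by omega) _
        rw [pow_succ] at hRc ⊢
        nlinarith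
      · intro x hx
        by_cases hx₀ : ∃ z ∈ W, (∀ f ∈ F, SignType.sign (f z) = SignType.sign (f x)) ∧ v z = 0
        · obtain ⟨z, hzW, hzs, hz⟩ := hx₀
          obtain ⟨r, hr, -, hrs⟩ := hR₀ z ⟨hzW, hz⟩
          have := hp (SignType.sign (v x)) r
            ⟨x, hx, fun f hf => ((hrs f hf).trans (hzs f hf)).symm, rfl⟩
          refine ⟨p (SignType.sign (v x)) r, mem_union_right _ (mem_image.2
            ⟨(SignType.sign (v x), r), by simp [hr], rfl⟩), this.1, ?_⟩
          simp only [forall_mem_insert]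
          exact ⟨this.2.2, fun f hf => (this.2.1 f hf).trans ((hrs f hf).trans (hzs f hf))⟩
        · obtain ⟨r, hr, hrW, hrs⟩ := hR x hx
          refine ⟨r, mem_union_left _ hr, hrW, ?_⟩
          simp only [forall_mem_insert]
          refine ⟨?_, hrs⟩
          by_contra hne
          push Not at hx₀
          have hvx : v x ≠ 0 := hx₀ x hx fun _ _ => rfl
          have hvr : v r ≠ 0 := hx₀ r hrW hrs
          refine hx₀ (|v x| • r + |v r| • x)
            (W.add_mem (W.smul_mem _ hrW) (W.smul_mem _ hx)) (fun f hf => ?_) ?_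
          · simpa using sign_add_of_sign_eq (abs_pos.2 hvx) (abs_pos.2 hvr) (hrs f hf)
          · simp only [map_add, map_smul, smul_eq_mul]
            rcases lt_or_gt_of_ne hvx with h | h <;> rcases lt_or_gt_of_ne hvr with h' | h'
            · simp [sign_neg h, sign_neg h'] at hne
            · rw [abs_of_neg h, abs_of_pos h']; ring
            · rw [abs_of_pos h, abs_of_neg h']; ring
            · simp [sign_pos h, sign_pos h'] at hne

/-- If in every set of size `s + 1` at most `b` elements are bad with respect to the rest, then
some set of size `s` has few elements outside that are bad with respect to it. -/
theorem exists_card_bad_le {ι : Type*} [Fintype ι] [DecidableEq ι]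
    (P : Finset ι → ι → Prop) [∀ I, DecidablePred (P I)] {s b : ℕ}
    (hs : s ≤ Fintype.card ι)
    (hP : ∀ J : Finset ι, J.card = s + 1 → (J.filter fun i => P (J.erase i) i).card ≤ b) :
    ∃ I : Finset ι, I.card = s ∧
      (s + 1) * (univ.filter fun i => i ∉ I ∧ P I i).card ≤ (Fintype.card ι - s) * b := by
  by_contra! hcon
  have hle : ∑ I ∈ powersetCard s (univ : Finset ι), (univ.filter fun i => i ∉ I ∧ P I i).card
      ≤ (Fintype.card ι).choose (s + 1) * b := by
    calc _ = ((powersetCard s (univ : Finset ι)).sigma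
              fun I => univ.filter fun i => i ∉ I ∧ P I i).card := (card_sigma _ _).symm
      _ ≤ ((powersetCard (s + 1) (univ : Finset ι)).sigma
              fun J => J.filter fun i => P (J.erase i) i).card := by
        refine card_le_card_of_injOn (fun y => ⟨insert y.2 y.1, y.2⟩) ?_ ?_
        · rintro ⟨I, i⟩ h
          simp only [coe_sigma, Set.mem_sigma_iff, mem_coe, mem_powersetCard, mem_filter] at h ⊢
          obtain ⟨⟨-, hI⟩, -, hi, hPi⟩ := h
          refine ⟨⟨subset_univ _, by rw [card_insert_of_notMem hi, hI]⟩, mem_insert_self _ _, ?_⟩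
          rwa [erase_insert hi]
        · rintro ⟨I, i⟩ h ⟨I', i'⟩ h' heq
          simp only [coe_sigma, Set.mem_sigma_iff, mem_coe, mem_filter] at h h'
          simp only [Sigma.mk.injEq, heq_eq_eq] at heq
          obtain ⟨h₁, rfl⟩ := heq
          have := congrArg (fun J => J.erase i) h₁
          simp only [erase_insert h.2.2.1, erase_insert h'.2.2.1] at this
          rw [this]
      _ = ∑ J ∈ powersetCard (s + 1) (univ : Finset ι),
            (J.filter fun i => P (J.erase i) i).card := card_sigma _ _
      _ ≤ (powersetCard (s + 1) (univ : Finset ι)).card • b :=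
        sum_le_card_nsmul _ _ _ fun J hJ => hP J (mem_powersetCard.1 hJ).2
      _ = _ := by rw [card_powersetCard, card_univ, smul_eq_mul]
  have hlt : ∑ I ∈ powersetCard s (univ : Finset ι), (Fintype.card ι - s) * b <
      ∑ I ∈ powersetCard s (univ : Finset ι),
        (s + 1) * (univ.filter fun i => i ∉ I ∧ P I i).card :=
    sum_lt_sum_of_nonempty (powersetCard_nonempty.2 (by simpa using hs))
      fun I hI => hcon I (mem_powersetCard.1 hI).2
  rw [sum_const, card_powersetCard, card_univ, smul_eq_mul, ← mul_sum, ← mul_assoc,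
    ← Nat.choose_succ_right_eq] at hlt
  nlinarith

/-- If each function `g` determines, independently of its values on `Q`, at most `K` sets of
density at most `1 / 8`, then few functions map `Q` into one of the sets they determine. -/
theorem card_maps_into_sparse_le {ι X : Type*} [Fintype ι] [DecidableEq ι] [Fintype X]
    [DecidableEq X]
    (𝓕 : (ι → X) → Finset (Finset X)) (K : ℕ) (hK : ∀ g, (𝓕 g).card ≤ K)
    (h𝓕 : ∀ g, ∀ A ∈ 𝓕 g, 8 * A.card ≤ Fintype.card X) (Q : Finset ι)
    (hQ : ∀ g g' : ι → X, (∀ i ∉ Q, g i = g' i) → 𝓕 g = 𝓕 g') :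
    8 ^ Q.card * (univ.filter fun g : ι → X => ∃ A ∈ 𝓕 g, ∀ i ∈ Q, g i ∈ A).card ≤
      K * Fintype.card X ^ Fintype.card ι := by
  rcases isEmpty_or_nonempty X with hX | hX
  · rcases isEmpty_or_nonempty ι with hι | ⟨⟨i⟩⟩
    · have hQe : Q = ∅ := Subsingleton.elim _ _
      subst hQe
      have : (univ.filter fun g : ι → X => ∃ A ∈ 𝓕 g, ∀ i ∈ (∅ : Finset ι), g i ∈ A).card
          ≤ K := by
        by_cases hK0 : K = 0
        · subst hK0
          simp only [nonpos_iff_eq_zero, card_eq_zero] at hK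
          simp [hK]
        · exact (card_le_univ _).trans (by simp; omega)
      simpa using this
    · have : IsEmpty (ι → X) := ⟨fun g => hX.elim (g i)⟩
      simp
  set T : Finset ι → Finset (Σ _ : ι → X, Finset X) := fun Q' =>
    (univ.sigma 𝓕).filter fun y => ∀ i ∈ Q', y.1 i ∈ y.2 with hT
  have key : ∀ Q' ⊆ Q, 8 ^ Q'.card * (T Q').card ≤ K * Fintype.card X ^ Fintype.card ι := by
    intro Q'
    induction Q' using Finset.induction_on with
    | empty =>
      intro _
      calc _ ≤ (univ.sigma 𝓕).card := by simp [hT]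
        _ = ∑ g, (𝓕 g).card := card_sigma _ _
        _ ≤ (univ : Finset (ι → X)).card • K := sum_le_card_nsmul _ _ _ fun g _ => hK g
        _ = _ := by simp [mul_comm]
    | insert q Q' hq ih =>
      intro hsub
      have hqQ : q ∈ Q := hsub (mem_insert_self _ _)
      have ih' := ih ((subset_insert _ _).trans hsub)
      have hcard : (T (insert q Q') ×ˢ (univ : Finset X)).card ≤
          ((T Q').sigma fun y => y.2).card := by
        refine card_le_card_of_injOn
          (fun y => ⟨⟨Function.update y.1.1 q y.2, y.1.2⟩, y.1.1 q⟩) ?_ ?_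
        · rintro ⟨⟨g, A⟩, a⟩ h
          simp only [hT, coe_product, Set.mem_prod, mem_coe, mem_filter, mem_sigma, mem_univ,
            true_and, forall_mem_insert, and_true, coe_sigma, Set.mem_sigma_iff] at h ⊢
          refine ⟨⟨?_, fun i hi => ?_⟩, h.2.1⟩
          · rw [hQ _ g fun i hi => Function.update_of_ne (fun (h : i = q) => hi (h ▸ hqQ)) _ _]
            exact h.1
          · rw [Function.update_of_ne (fun h : i = q => hq (h ▸ hi))]
            exact h.2.2 i hi
        · rintro ⟨⟨g, A⟩, a⟩ - ⟨⟨g', A'⟩, a'⟩ - heq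
          simp only [Sigma.mk.injEq, heq_eq_eq] at heq
          obtain ⟨⟨h₁, rfl⟩, h₂⟩ := heq
          have ha : a = a' := by simpa using congrFun h₁ q
          have hg : g = g' := by
            funext i
            by_cases hi : i = q
            · rw [hi, h₂]
            · simpa [hi] using congrFun h₁ i
          rw [ha, hg]
      rw [card_product, card_univ, card_sigma] at hcard
      have hsum : 8 * ∑ y ∈ T Q', y.2.card ≤ (T Q').card * Fintype.card X := by
        rw [mul_sum, ← smul_eq_mul (T Q').card]
        refine sum_le_card_nsmul _ _ _ fun y hy => h𝓕 y.1 y.2 ?_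
        exact (mem_sigma.1 (mem_filter.1 hy).1).2
      have h8 : 8 * (T (insert q Q')).card ≤ (T Q').card :=
        Nat.le_of_mul_le_mul_right (by nlinarith) (Fintype.card_pos (α := X))
      rw [card_insert_of_notMem hq, pow_succ, mul_assoc]
      exact (Nat.mul_le_mul_left _ h8).trans ih'
  refine le_trans (Nat.mul_le_mul_left _ ?_) (key Q subset_rfl)
  refine le_trans (card_le_card ?_) (card_image_le (s := T Q) (f := fun y => y.1))
  intro g hg
  obtain ⟨A, hA, h⟩ := (mem_filter.1 hg).2
  exact mem_image.2 ⟨⟨g, A⟩, mem_filter.2 ⟨mem_sigma.2 ⟨mem_univ _, hA⟩, h⟩, rfl⟩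

theorem Infers.mono {n : ℕ} {S T : Finset (Fin n → ℝ)} {x h : Fin n → ℝ}
    (hST : S ⊆ T) (hS : Infers S x h) : Infers T x h := fun x' h₁ h₂ =>
  hS x' (fun v hv => h₁ v (hST hv)) fun v hv w hw => h₂ v (hST hv) w (hST hw)

theorem infers_of_mem {n : ℕ} {S : Finset (Fin n → ℝ)} {x h : Fin n → ℝ}
    (hh : h ∈ S) : Infers S x h := fun _ h₁ _ => h₁ h hh

theorem Infers.congr {n : ℕ} {S : Finset (Fin n → ℝ)} {x r h : Fin n → ℝ}
    (h₁ : ∀ v ∈ S, SignType.sign (ip r v) = SignType.sign (ip x v))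
    (h₂ : ∀ v ∈ S, ∀ w ∈ S, SignType.sign (ip r (v - w)) = SignType.sign (ip x (v - w)))
    (hx : Infers S x h) : Infers S r h := fun x' h₁' h₂' =>
  (hx x' (fun v hv => (h₁' v hv).trans (h₁ v hv))
    fun v hv w hw => (h₂' v hv w hw).trans (h₂ v hv w hw)).trans (hx r h₁ h₂).symm

/-- A set of size `s` distinguishes, as far as inference is concerned, at most
`(3 * (s + s ^ 2) + 1) ^ n` points. -/
theorem exists_infers_representatives {n : ℕ} (S : Finset (Fin n → ℝ)) :
    ∃ R : Finset (Fin n → ℝ), R.card ≤ (3 * (S.card + S.card ^ 2) + 1) ^ n ∧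
      ∀ x, ∃ r ∈ R, ∀ h, Infers S r h ↔ Infers S x h := by
  let φ : (Fin n → ℝ) → Module.Dual ℝ (Fin n → ℝ) := fun v => (dotProductBilin ℝ ℝ).flip v
  have hφ : ∀ x v, φ v x = ip x v := fun x v => rfl
  obtain ⟨R, hRc, hR⟩ := exists_sign_representatives
    ((S ∪ (S ×ˢ S).image fun y => y.1 - y.2).image φ) ⊤
  refine ⟨R, hRc.trans ?_, fun x => ?_⟩
  · rw [finrank_top, Module.finrank_fin_fun]
    refine Nat.pow_le_pow_left ?_ _
    have h₁ := card_image_le (s := S ∪ (S ×ˢ S).image fun y => y.1 - y.2) (f := φ)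
    have h₂ := card_union_le S ((S ×ˢ S).image fun y => y.1 - y.2)
    have h₃ := card_image_le (s := S ×ˢ S) (f := fun y => y.1 - y.2)
    rw [card_product] at h₃
    nlinarith
  · obtain ⟨r, hr, -, hs⟩ := hR x trivial
    have h₁ : ∀ v ∈ S, SignType.sign (ip r v) = SignType.sign (ip x v) := fun v hv =>
      hs (φ v) (mem_image_of_mem _ (mem_union_left _ hv))
    have h₂ : ∀ v ∈ S, ∀ w ∈ S, SignType.sign (ip r (v - w)) = SignType.sign (ip x (v - w)) :=
      fun v hv w hw => hs (φ (v - w)) (mem_image_of_mem _ (mem_union_right _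
        (mem_image.2 ⟨(v, w), mem_product.2 ⟨hv, hw⟩, rfl⟩)))
    exact ⟨r, hr, fun h => ⟨Infers.congr (fun v hv => (h₁ v hv).symm)
      fun v hv w hw => (h₂ v hv w hw).symm, Infers.congr h₁ h₂⟩⟩

/-- In a finite family from a set of inference dimension at most `d`, fewer than `d` members are
not inferred by the other members. -/
theorem InfProp.card_not_infers_lt {n d : ℕ} {H : Finset (Fin n → ℝ)} (hH : InfProp H d)
    {ι : Type*} [DecidableEq ι] (g : ι → Fin n → ℝ) (hg : ∀ i, g i ∈ H) (J : Finset ι)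
    (x : Fin n → ℝ) :
    (J.filter fun i => ¬ Infers ((J.erase i).image g) x (g i)).card < d := by
  by_contra! hcon
  set B := J.filter fun i => ¬ Infers ((J.erase i).image g) x (g i) with hB
  have hinj : Set.InjOn g B := by
    intro i hi j hj hij
    by_contra hne
    refine (mem_filter.1 hi).2 (infers_of_mem (mem_image.2 ⟨j, ?_, hij.symm⟩))
    exact mem_erase.2 ⟨Ne.symm hne, (mem_filter.1 hj).1⟩
  obtain ⟨h, hh, hinf⟩ := hH (B.image g) (image_subset_iff.2 fun i _ => hg i)
    (by rwa [card_image_of_injOn hinj]) x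
  obtain ⟨i, hi, rfl⟩ := mem_image.1 hh
  refine (mem_filter.1 hi).2 (hinf.mono fun v hv => ?_)
  obtain ⟨hne, hv⟩ := mem_erase.1 hv
  obtain ⟨j, hj, rfl⟩ := mem_image.1 hv
  exact mem_image_of_mem _ (mem_erase.2 ⟨fun h => hne (h ▸ rfl), (mem_filter.1 hj).1⟩)

/-- Some tuple of suitable length from `H` infers an eighth of `H` at every point. -/
theorem InfProp.exists_universal_tuple {n d L q : ℕ} {H : Finset (Fin n → ℝ)}
    (hH : InfProp H d) (hne : H.Nonempty) (hd : 2 ≤ d) (hL : d ≤ 2 ^ L)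
    (hq : 8 * d + 8 * n * L < q) :
    ∃ g : Fin (4 * d + 4 * q) → H, ∀ x, H.card ≤
      8 * (H.filter fun h => Infers (univ.image fun i => (g i : Fin n → ℝ)) x h).card := by
  by_contra! hbad
  set m := 4 * d + 4 * q with hm
  have hm4 : m - 4 * d = 4 * q := by omega
  choose R hRc hR using fun S : Finset (Fin n → ℝ) => exists_infers_representatives S
  let img : Finset (Fin m) → (Fin m → H) → Finset (Fin n → ℝ) :=
    fun I g => I.image fun i => (g i : Fin n → ℝ)
  let 𝓕 : Finset (Fin m) → (Fin m → H) → Finset (Finset H) := fun I g =>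
    ((R (img I g)).image fun r => univ.filter fun h : H => Infers (img I g) r h).filter
      fun A => 8 * A.card ≤ Fintype.card H
  let pairs : Finset (Finset (Fin m) × Finset (Fin m)) :=
    univ.filter fun y => y.1.card = 4 * d ∧ y.2.card = 3 * q ∧ Disjoint y.1 y.2
  let bad : Finset (Fin m) × Finset (Fin m) → Finset (Fin m → H) := fun y =>
    univ.filter fun g => ∃ A ∈ 𝓕 y.1 g, ∀ i ∈ y.2, g i ∈ A
  have hcount : ∀ y ∈ pairs, 2 ^ (9 * q) * (bad y).card ≤ 2 ^ (8 * n * L) * H.card ^ m := by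
    rintro ⟨I, Q⟩ hy
    obtain ⟨-, hI, hQ, hdisj⟩ := mem_filter.1 hy
    simp only at hI hQ hdisj
    have := card_maps_into_sparse_le (𝓕 I) (2 ^ (8 * n * L)) (fun g => ?_)
      (fun g A hA => (mem_filter.1 hA).2) Q (fun g g' hgg' => ?_)
    · have h8 : 8 ^ (3 * q) = 2 ^ (9 * q) := by
        rw [show 8 = 2 ^ 3 by norm_num, ← pow_mul]
        ring_nf
      rw [hQ, Fintype.card_coe, Fintype.card_fin, h8] at this
      convert this using 3
      ext g
      simp only [bad, mem_filter]
    · have hc : (img I g).card ≤ 4 * d := hI ▸ card_image_le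
      calc (𝓕 I g).card ≤ (R (img I g)).card := (card_filter_le _ _).trans card_image_le
        _ ≤ (3 * ((img I g).card + (img I g).card ^ 2) + 1) ^ n := hRc _
        _ ≤ (d ^ 8) ^ n := by
          refine Nat.pow_le_pow_left ?_ _
          have h₁ : (img I g).card ^ 2 ≤ (4 * d) ^ 2 := Nat.pow_le_pow_left hc 2
          have h₂ : 2 ^ 6 ≤ d ^ 6 := Nat.pow_le_pow_left hd 6
          have h₃ : d ^ 8 = d ^ 6 * d ^ 2 := by ring
          have h₄ : 2 ^ 6 * d ^ 2 ≤ d ^ 6 * d ^ 2 := Nat.mul_le_mul_right _ h₂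
          nlinarith
        _ ≤ ((2 ^ L) ^ 8) ^ n := Nat.pow_le_pow_left (Nat.pow_le_pow_left hL _) _
        _ = 2 ^ (8 * n * L) := by rw [← pow_mul, ← pow_mul]; ring_nf
    · have himg : img I g = img I g' := image_congr fun i hi => by
        simp only [hgg' i (disjoint_left.1 hdisj hi)]
      simp only [𝓕, himg]
  have hcover : (univ : Finset (Fin m → H)) ⊆ pairs.biUnion bad := by
    intro g _
    obtain ⟨x, hx⟩ := hbad g
    obtain ⟨I, hI, hIb⟩ := exists_card_bad_le (s := 4 * d) (b := d)
      (fun (I : Finset (Fin m)) i => ¬ Infers (img I g) x (g i)) (by simp [hm])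
      (fun J _ => (hH.card_not_infers_lt _ (fun i => (g i).2) J x).le)
    rw [Fintype.card_fin, hm4] at hIb
    set b := (univ.filter fun i => i ∉ I ∧ ¬ Infers (img I g) x (g i)).card with hb
    have hbq : b ≤ q := by
      by_contra! h
      nlinarith
    have hsplit : (univ.filter fun i => i ∉ I ∧ Infers (img I g) x (g i)).card + b = 4 * q := by
      have h₁ := card_filter_add_card_filter_not (s := Iᶜ)
        (fun i => Infers (img I g) x (g i))
      rw [card_compl, Fintype.card_fin, hI, hm4] at h₁
      rw [hb, ← h₁]
      congr 2 <;> ext i <;> simp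
    obtain ⟨Q, hQsub, hQc⟩ := exists_subset_card_eq (n := 3 * q)
      (s := univ.filter fun i => i ∉ I ∧ Infers (img I g) x (g i)) (by omega)
    obtain ⟨r, hr, hrx⟩ := hR (img I g) x
    refine mem_biUnion.2 ⟨(I, Q), mem_filter.2 ⟨mem_univ _, hI, hQc, ?_⟩,
      mem_filter.2 ⟨mem_univ _, _, mem_filter.2 ⟨mem_image_of_mem _ hr, ?_⟩, fun i hi => ?_⟩⟩
    · exact disjoint_right.2 fun i hi => (mem_filter.1 (hQsub hi)).2.1
    · rw [Fintype.card_coe]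
      refine le_trans (Nat.mul_le_mul_left _ ?_) hx.le
      refine card_le_card_of_injOn (fun h => (h : Fin n → ℝ)) (fun h hh => ?_)
        Subtype.val_injective.injOn
      refine mem_coe.2 (mem_filter.2 ⟨h.2, ?_⟩)
      exact ((hrx h).1 (mem_filter.1 hh).2).mono (image_subset_image (subset_univ _))
    · exact mem_filter.2 ⟨mem_univ _, (hrx _).2 (mem_filter.1 (hQsub hi)).2.2⟩
  have hpairs : pairs.card ≤ 2 ^ (2 * m) := by
    refine (card_le_univ _).trans_eq ?_
    rw [Fintype.card_prod, Fintype.card_finset, Fintype.card_fin, ← pow_add, two_mul]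
  have hpos : 0 < H.card ^ m := pow_pos hne.card_pos _
  have htotal : 2 ^ (9 * q) * H.card ^ m ≤ 2 ^ (2 * m) * (2 ^ (8 * n * L) * H.card ^ m) :=
    calc 2 ^ (9 * q) * H.card ^ m = 2 ^ (9 * q) * (univ : Finset (Fin m → H)).card := by simp
      _ ≤ 2 ^ (9 * q) * ∑ y ∈ pairs, (bad y).card :=
        Nat.mul_le_mul_left _ ((card_le_card hcover).trans card_biUnion_le)
      _ = ∑ y ∈ pairs, 2 ^ (9 * q) * (bad y).card := mul_sum _ _ _
      _ ≤ pairs.card • (2 ^ (8 * n * L) * H.card ^ m) := sum_le_card_nsmul _ _ _ hcount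
      _ ≤ _ := Nat.mul_le_mul_right _ hpairs
  rw [← mul_assoc, ← pow_add] at htotal
  have := (Nat.pow_le_pow_iff_right (by norm_num : 1 < 2)).1
    (Nat.le_of_mul_le_mul_right htotal hpos)
  omega

/-- Lemma 5.2, universal sample: there is a universal constant `C > 0` such
that any finite `H ⊆ ℝ^n` of inference dimension `d ≥ 2` has a subset `S ⊆ H` of size
`|S| ≤ min(|H|, C·(d + n·log₂ d))` with `|infer(S,x) ∩ H| ≥ |H|/8` for every `x ∈ ℝ^n`. -/
theorem universal_sample :
    ∃ C : ℝ, 0 < C ∧ ∀ (n : ℕ) (H : Finset (Fin n → ℝ)) (d : ℕ),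
      2 ≤ d → InfProp H d →
      ∃ S ⊆ H, ((S.card : ℝ) ≤ min (H.card : ℝ) (C * (d + n * Real.logb 2 d))) ∧
        ∀ x : Fin n → ℝ,
          (H.card : ℝ) / 8 ≤ ((H.filter (fun h => Infers S x h)).card : ℝ) := by
  refine ⟨68, by norm_num, fun n H d hd hH => ?_⟩
  have hlog : (1 : ℝ) ≤ Real.logb 2 d := by
    rw [Real.le_logb_iff_rpow_le (by norm_num) (by positivity), Real.rpow_one]
    exact_mod_cast hd
  rcases H.eq_empty_or_nonempty with rfl | hne
  · refine ⟨∅, subset_rfl, ?_, fun x => by simp⟩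
    have : (0 : ℝ) ≤ 68 * (d + n * Real.logb 2 d) := by positivity
    simpa using this
  obtain ⟨g, hg⟩ := hH.exists_universal_tuple (L := Nat.log 2 d + 1)
    (q := 8 * d + 8 * n * (Nat.log 2 d + 1) + 1) hne hd
    (Nat.lt_pow_succ_log_self (by norm_num) d).le (Nat.lt_succ_self _)
  have hsub : (univ.image fun i => (g i : Fin n → ℝ)) ⊆ H :=
    image_subset_iff.2 fun i _ => (g i).2
  refine ⟨_, hsub, le_min (by exact_mod_cast card_le_card hsub) ?_, fun x => ?_⟩
  · have hcard := card_image_le (s := univ) (f := fun i => (g i : Fin n → ℝ))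
    rw [card_univ, Fintype.card_fin] at hcard
    have hcard' : ((univ.image fun i => (g i : Fin n → ℝ)).card : ℝ) ≤
        4 * d + 4 * (8 * d + 8 * n * (Nat.log 2 d + 1) + 1) := by exact_mod_cast hcard
    have hle : (Nat.log 2 d : ℝ) ≤ Real.logb 2 d := by
      exact_mod_cast Real.natLog_le_logb d 2
    have hmul : (n : ℝ) * (Nat.log 2 d + 1) ≤ n * (2 * Real.logb 2 d) :=
      mul_le_mul_of_nonneg_left (by linarith) (by positivity)
    have hd' : (2 : ℝ) ≤ d := by exact_mod_cast hd
    nlinarith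
  · have := hg x
    rw [div_le_iff₀ (by norm_num), mul_comm]
    exact_mod_cast this

end LDT
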